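/- Let d ≥ 1 and p ∈ [1,∞). (1) There is a constant C = C(d,p) such that for every η ∈ (0,1), every countable family of cubes Q_k ⊂ ℝ^d with measurable subsets E_k ⊆ Q_k satisfying |E_k| ≥ η|Q_k|, and every choice of λ_k ≥ 0, one has ‖Σ_k λ_k 1_{Q_k}‖_{L^p} ≤ (C/η)·‖Σ_k λ_k 1_{E_k}‖_{L^p}. (2) Moreover, for every A ≥ 1, if instead each E_k is replaced by a cube Q̃_k with ℓ(Q̃_k) = ℓ(Q_k) and dist(Q_k, Q̃_k) ≤ A·ℓ(Q_k), then ‖Σ_k λ_k 1_{Q_k}‖_{L^p} ≤ C·A^d·‖Σ_k λ_k 1_{Q̃_k}‖_{L^p}. -/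

import Mathlib

open MeasureTheory Metric Filter ENNReal

/-- The closed axis-parallel cube with corner `c` and side length `ℓ` in `ℝ^d`. -/
def cube {d : ℕ} (c : EuclideanSpace ℝ (Fin d)) (ℓ : ℝ) : Set (EuclideanSpace ℝ (Fin d)) :=
  {x | ∀ i, c i ≤ x i ∧ x i ≤ c i + ℓ}

theorem ENNReal.rpow_one_div_le_of_le_mul_rpow {p q : ℝ} (hpq : p.HolderConjugate q)
    {X B : ℝ≥0∞} (hX : X ≠ ∞) (h : X ≤ B * X ^ (1 / q)) : X ^ (1 / p) ≤ B := by
  rcases eq_or_ne X 0 with rfl | h0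
  · simp [ENNReal.zero_rpow_of_pos (inv_pos.2 hpq.pos)]
  have hne : X ^ (1 / q) ≠ 0 := by simp [ENNReal.rpow_eq_zero_iff, h0, hX]
  have hnt : X ^ (1 / q) ≠ ∞ := by simp [ENNReal.rpow_eq_top_iff, h0, hX]
  rw [← ENNReal.mul_le_mul_iff_left hne hnt, ← ENNReal.rpow_add _ _ h0 hX]
  simpa [hpq.inv_add_inv_eq_one] using h

section Maximal

variable {α ι : Type*} [MeasurableSpace α] {μ : Measure α}

/-- A function satisfying the Doob-type weak estimate `t μ{M > t} ≤ K ∫_{M > t} g` satisfies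
`∫ M ^ q ≤ K p ∫ g M ^ (q - 1)` for conjugate exponents `p`, `q`. -/
theorem lintegral_rpow_le_of_mul_meas_lt_le {p q : ℝ} (hpq : p.HolderConjugate q)
    {M g : α → ℝ≥0∞} (hM : Measurable M) (hMtop : ∀ x, M x ≠ ∞) (hg : Measurable g)
    (K : ℝ≥0∞) (h : ∀ t, t * μ {x | t < M x} ≤ K * ∫⁻ x in {x | t < M x}, g x ∂μ) :
    ∫⁻ x, M x ^ q ∂μ ≤ K * ENNReal.ofReal p * ∫⁻ x, g x * M x ^ (q - 1) ∂μ := by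
  have hq := hpq.symm.lt
  have hpow (r : ℝ) (hr : 0 < r) (x : α) : ENNReal.ofReal ((M x).toReal ^ r) = M x ^ r := by
    rw [ENNReal.toReal_rpow, ENNReal.ofReal_toReal (by simp [hr.le, hMtop])]
  have key (ν : Measure α) (r : ℝ) (hr : 0 < r) :
      ∫⁻ x, M x ^ r ∂ν = ENNReal.ofReal r * ∫⁻ t in Set.Ioi (0 : ℝ),
        ν {x | ENNReal.ofReal t < M x} * ENNReal.ofReal (t ^ (r - 1)) := by
    simp_rw [← hpow r hr]
    rw [lintegral_rpow_eq_lintegral_meas_lt_mul ν (ae_of_all _ fun x => ENNReal.toReal_nonneg)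
      hM.ennreal_toReal.aemeasurable hr]
    congr 1
    refine setLIntegral_congr_fun measurableSet_Ioi fun t ht => ?_
    simp_rw [ENNReal.ofReal_lt_iff_lt_toReal (le_of_lt ht) (hMtop _)]
  have hν : ∫⁻ x, g x * M x ^ (q - 1) ∂μ = ∫⁻ x, M x ^ (q - 1) ∂(μ.withDensity g) :=
    (lintegral_withDensity_eq_lintegral_mul μ hg (hM.pow_const _)).symm
  rw [hν, key _ _ (sub_pos.2 hq), key _ _ hpq.symm.pos, ← mul_assoc, mul_assoc K,
    ← ENNReal.ofReal_mul hpq.nonneg, hpq.symm.conjugate_eq, div_mul_cancel₀ _ (sub_pos.2 hq).ne',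
    mul_comm K, mul_assoc]
  gcongr
  have hmeas : Measurable fun t : ℝ => (μ.withDensity g) {x | ENNReal.ofReal t < M x} *
      ENNReal.ofReal (t ^ (q - 1 - 1)) := by
    refine Measurable.mul (Antitone.measurable fun s t hst => measure_mono fun x hx => ?_)
      (by fun_prop)
    exact lt_of_le_of_lt (ENNReal.ofReal_le_ofReal hst) hx
  rw [← lintegral_const_mul _ hmeas]
  refine setLIntegral_mono (hmeas.const_mul _) fun t (ht : 0 < t) => ?_
  have hsplit : t ^ (q - 1) = t * t ^ (q - 1 - 1) := by
    rw [mul_comm, ← Real.rpow_add_one ht.ne', sub_add_cancel]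
  rw [hsplit, ENNReal.ofReal_mul ht.le, ← mul_assoc, ← mul_assoc,
    withDensity_apply _ (measurableSet_lt measurable_const hM), mul_comm (μ _)]
  exact mul_le_mul_left (h _) _

theorem lintegral_rpow_finset_sum_indicator_ne_top {S : Finset ι} {Q : ι → Set α}
    (hQ : ∀ k ∈ S, MeasurableSet (Q k)) (hQtop : ∀ k ∈ S, μ (Q k) ≠ ∞) {b : ι → ℝ≥0∞}
    (hb : ∀ k ∈ S, b k ≠ ∞) {q : ℝ} (hq : 1 ≤ q) :
    ∫⁻ x, (∑ k ∈ S, b k * (Q k).indicator (fun _ => 1) x) ^ q ∂μ ≠ ∞ := by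
  have hB (x : α) : ∑ k ∈ S, b k * (Q k).indicator (fun _ => 1) x ≤ ∑ k ∈ S, b k :=
    Finset.sum_le_sum fun k _ => mul_le_of_le_one_right' (Set.indicator_le_self' (by simp) x)
  have hint : ∫⁻ x, ∑ k ∈ S, b k * (Q k).indicator (fun _ => 1) x ∂μ ≠ ∞ := by
    rw [lintegral_finsetSum' _ fun k hk =>
      ((measurable_const.indicator (hQ k hk)).const_mul _).aemeasurable]
    refine ENNReal.sum_ne_top.2 fun k hk => ?_
    rw [lintegral_const_mul _ (measurable_const.indicator (hQ k hk)),
      lintegral_indicator_const (hQ k hk), one_mul]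
    exact ENNReal.mul_ne_top (hb k hk) (hQtop k hk)
  refine ne_top_of_le_ne_top (ENNReal.mul_ne_top (ENNReal.rpow_ne_top_of_nonneg
    (sub_nonneg.2 hq) (ENNReal.sum_ne_top.2 hb)) hint) ?_
  rw [← lintegral_const_mul' _ _ (ENNReal.rpow_ne_top_of_nonneg
    (sub_nonneg.2 hq) (ENNReal.sum_ne_top.2 hb))]
  refine lintegral_mono fun x => ?_
  calc _ = (∑ k ∈ S, b k * (Q k).indicator (fun _ => 1) x) ^ ((q - 1) + 1) := by
        rw [sub_add_cancel]
    _ = _ := by rw [ENNReal.rpow_add_of_nonneg _ _ (sub_nonneg.2 hq) zero_le_one, ENNReal.rpow_one]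
    _ ≤ _ := mul_le_mul_left (ENNReal.rpow_le_rpow (hB x) (sub_nonneg.2 hq)) _

/-- The maximal function of `g` over a finite family of sets. -/
noncomputable def finsetMaximal (μ : Measure α) (S : Finset ι) (Q : ι → Set α) (g : α → ℝ≥0∞)
    (x : α) : ℝ≥0∞ :=
  S.sup fun k => (Q k).indicator (fun _ => ⨍⁻ y in Q k, g y ∂μ) x

theorem measurable_finsetMaximal {S : Finset ι} {Q : ι → Set α}
    (hQ : ∀ k ∈ S, MeasurableSet (Q k)) (g : α → ℝ≥0∞) : Measurable (finsetMaximal μ S Q g) := by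
  have : finsetMaximal μ S Q g =
      fun x => ⨆ k ∈ S, (Q k).indicator (fun _ => ⨍⁻ y in Q k, g y ∂μ) x :=
    funext fun x => Finset.sup_eq_iSup _ _
  rw [this]
  exact Measurable.biSup (S : Set ι) S.countable_toSet fun k hk =>
    measurable_const.indicator (hQ k hk)

theorem setLAverage_le_finsetMaximal {S : Finset ι} {Q : ι → Set α} (g : α → ℝ≥0∞) {k : ι}
    (hk : k ∈ S) {x : α} (hx : x ∈ Q k) : ⨍⁻ y in Q k, g y ∂μ ≤ finsetMaximal μ S Q g x := by
  have := Finset.le_sup (f := fun k => (Q k).indicator (fun _ => ⨍⁻ y in Q k, g y ∂μ) x) hk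
  rwa [Set.indicator_of_mem hx] at this

theorem finsetMaximal_le_sum (S : Finset ι) (Q : ι → Set α) (g : α → ℝ≥0∞) (x : α) :
    finsetMaximal μ S Q g x ≤
      ∑ k ∈ S, (⨍⁻ y in Q k, g y ∂μ) * (Q k).indicator (fun _ => 1) x := by
  refine Finset.sup_le fun k hk => ?_
  refine le_trans ?_ (Finset.single_le_sum (fun _ _ => zero_le) hk)
  by_cases hx : x ∈ Q k <;> simp [hx]

/-- The finite family `Q` satisfies a Vitali covering property with constant `K`: each subfamily
has a disjoint subfamily whose total measure controls the measure of the union. -/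
def VitaliProperty (μ : Measure α) (S : Finset ι) (Q : ι → Set α) (K : ℝ≥0∞) : Prop :=
  ∀ T ⊆ S, ∃ U ⊆ T, (U : Set ι).PairwiseDisjoint Q ∧ μ (⋃ k ∈ T, Q k) ≤ K * ∑ k ∈ U, μ (Q k)

theorem VitaliProperty.mul_meas_lt_finsetMaximal_le {S : Finset ι} {Q : ι → Set α} {K : ℝ≥0∞}
    (hV : VitaliProperty μ S Q K) (hQ : ∀ k ∈ S, MeasurableSet (Q k))
    (hQtop : ∀ k ∈ S, μ (Q k) ≠ ∞) (g : α → ℝ≥0∞) (t : ℝ≥0∞) :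
    t * μ {x | t < finsetMaximal μ S Q g x} ≤
      K * ∫⁻ x in {x | t < finsetMaximal μ S Q g x}, g x ∂μ := by
  classical
  obtain ⟨U, hUT, hdisj, hU⟩ := hV (S.filter fun k => t < ⨍⁻ y in Q k, g y ∂μ)
    (Finset.filter_subset _ _)
  have hsub : {x | t < finsetMaximal μ S Q g x} ⊆
      ⋃ k ∈ S.filter fun k => t < ⨍⁻ y in Q k, g y ∂μ, Q k := by
    intro x hx
    obtain ⟨k, hk, hkx⟩ := Finset.lt_sup_iff.1 (show t < S.sup _ from hx)
    have hxk : x ∈ Q k := by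
      by_contra hxk
      simp [hxk] at hkx
    rw [Set.indicator_of_mem hxk] at hkx
    exact Set.mem_biUnion (Finset.mem_coe.2 (Finset.mem_filter.2 ⟨hk, hkx⟩)) hxk
  have hsup : ⋃ k ∈ U, Q k ⊆ {x | t < finsetMaximal μ S Q g x} := by
    intro x hx
    obtain ⟨k, hk, hxk⟩ := Set.mem_iUnion₂.1 hx
    obtain ⟨hkS, hkt⟩ := Finset.mem_filter.1 (hUT hk)
    exact hkt.trans_le (setLAverage_le_finsetMaximal g hkS hxk)
  have hUS (k) (hk : k ∈ U) : k ∈ S := Finset.filter_subset _ _ (hUT hk)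
  calc t * μ {x | t < finsetMaximal μ S Q g x}
      ≤ t * (K * ∑ k ∈ U, μ (Q k)) := by gcongr; exact (measure_mono hsub).trans hU
    _ = K * ∑ k ∈ U, μ (Q k) * t := by
      rw [mul_left_comm, Finset.mul_sum]
      simp_rw [mul_comm t]
    _ ≤ K * ∑ k ∈ U, ∫⁻ x in Q k, g x ∂μ := by
      gcongr with k hk
      rw [← measure_mul_setLAverage _ (hQtop k (hUS k hk))]
      gcongr
      exact (Finset.mem_filter.1 (hUT hk)).2.le
    _ = K * ∫⁻ x in ⋃ k ∈ U, Q k, g x ∂μ := by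
      rw [lintegral_biUnion_finset hdisj fun k hk => hQ k (hUS k hk)]
    _ ≤ _ := by gcongr

/-- The strong `L^q` estimate for the maximal function of a finite Vitali family. -/
theorem VitaliProperty.lintegral_finsetMaximal_rpow_le {S : Finset ι} {Q : ι → Set α} {K : ℝ≥0∞}
    (hV : VitaliProperty μ S Q K) (hQ : ∀ k ∈ S, MeasurableSet (Q k))
    (hQ0 : ∀ k ∈ S, μ (Q k) ≠ 0) (hQtop : ∀ k ∈ S, μ (Q k) ≠ ∞)
    {p q : ℝ} (hpq : p.HolderConjugate q) {g : α → ℝ≥0∞} (hg : Measurable g)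
    (hgint : ∀ k ∈ S, ∫⁻ x in Q k, g x ∂μ ≠ ∞) :
    (∫⁻ x, finsetMaximal μ S Q g x ^ q ∂μ) ^ (1 / q) ≤
      K * ENNReal.ofReal p * (∫⁻ x, g x ^ q ∂μ) ^ (1 / q) := by
  have hM := measurable_finsetMaximal (μ := μ) hQ g
  have havg (k) (hk : k ∈ S) : ⨍⁻ y in Q k, g y ∂μ ≠ ∞ := by
    rw [setLAverage_eq]
    exact ENNReal.div_ne_top (hgint k hk) (hQ0 k hk)
  have hMtop (x : α) : finsetMaximal μ S Q g x ≠ ∞ := by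
    refine ne_top_of_le_ne_top (ENNReal.sum_ne_top.2 fun k hk => ?_) (finsetMaximal_le_sum S Q g x)
    refine ENNReal.mul_ne_top (havg k hk) (ne_top_of_le_ne_top ENNReal.one_ne_top
      (Set.indicator_le_self' (by simp) x))
  have hfin : ∫⁻ x, finsetMaximal μ S Q g x ^ q ∂μ ≠ ∞ := by
    refine ne_top_of_le_ne_top
      (lintegral_rpow_finset_sum_indicator_ne_top hQ hQtop havg hpq.symm.lt.le)
      (lintegral_mono fun x => ?_)
    exact ENNReal.rpow_le_rpow (finsetMaximal_le_sum S Q g x) hpq.symm.nonneg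
  refine ENNReal.rpow_one_div_le_of_le_mul_rpow hpq.symm hfin ?_
  refine (lintegral_rpow_le_of_mul_meas_lt_le hpq hM hMtop hg K
    (hV.mul_meas_lt_finsetMaximal_le hQ hQtop g)).trans ?_
  rw [mul_assoc (K * _)]
  refine mul_le_mul_right ?_ _
  refine (ENNReal.lintegral_mul_le_Lp_mul_Lq μ hpq.symm hg.aemeasurable
    (hM.pow_const (q - 1)).aemeasurable).trans_eq ?_
  simp_rw [← ENNReal.rpow_mul, hpq.symm.sub_one_mul_conj]

/-- Shrinking each set of a finite Vitali family to a subset of comparable measure changes the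
`L^p` norm of a positive combination of indicators by at most a constant factor. -/
theorem VitaliProperty.lintegral_sum_rpow_le {S : Finset ι} {Q E : ι → Set α} {K : ℝ≥0∞}
    (hV : VitaliProperty μ S Q K) (hK : 1 ≤ K) (hQ : ∀ k ∈ S, MeasurableSet (Q k))
    (hQ0 : ∀ k ∈ S, μ (Q k) ≠ 0) (hQtop : ∀ k ∈ S, μ (Q k) ≠ ∞)
    (hE : ∀ k ∈ S, MeasurableSet (E k)) (hEQ : ∀ k ∈ S, E k ⊆ Q k) {c : ℝ≥0∞}
    (hc : ∀ k ∈ S, μ (Q k) ≤ c * μ (E k)) {b : ι → ℝ≥0∞} (hb : ∀ k ∈ S, b k ≠ ∞)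
    {p : ℝ} (hp : 1 ≤ p) :
    (∫⁻ x, (∑ k ∈ S, b k * (Q k).indicator (fun _ => 1) x) ^ p ∂μ) ^ (1 / p) ≤
      c * (K * ENNReal.ofReal p) *
        (∫⁻ x, (∑ k ∈ S, b k * (E k).indicator (fun _ => 1) x) ^ p ∂μ) ^ (1 / p) := by
  have hsum {s : ι → Set α} (hs : ∀ k ∈ S, MeasurableSet (s k)) {f : α → ℝ≥0∞}
      (hf : Measurable f) :
      ∫⁻ x, (∑ k ∈ S, b k * (s k).indicator (fun _ => 1) x) * f x ∂μ =
        ∑ k ∈ S, b k * ∫⁻ x in s k, f x ∂μ := by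
    simp_rw [Finset.sum_mul, mul_assoc]
    rw [lintegral_finsetSum' S (f := fun k x => b k * ((s k).indicator (fun _ => 1) x * f x))
      fun k hk => (((measurable_const.indicator (hs k hk)).mul hf).const_mul _).aemeasurable]
    refine Finset.sum_congr rfl fun k hk => ?_
    rw [lintegral_const_mul' _ _ (hb k hk),
      ← lintegral_indicator (hs k hk)]
    congr 2 with x
    by_cases hx : x ∈ s k <;> simp [hx]
  have hmeas {s : ι → Set α} (hs : ∀ k ∈ S, MeasurableSet (s k)) :
      Measurable fun x => ∑ k ∈ S, b k * (s k).indicator (fun _ => (1 : ℝ≥0∞)) x :=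
    Finset.measurable_sum _ fun k hk => (measurable_const.indicator (hs k hk)).const_mul _
  rcases hp.eq_or_lt with rfl | hp1
  · have hsum1 {s : ι → Set α} (hs : ∀ k ∈ S, MeasurableSet (s k)) :
        ∫⁻ x, ∑ k ∈ S, b k * (s k).indicator (fun _ => 1) x ∂μ = ∑ k ∈ S, b k * μ (s k) := by
      simpa using hsum hs measurable_one
    simp only [ENNReal.rpow_one, div_one, ENNReal.ofReal_one, mul_one, hsum1 hQ, hsum1 hE]
    calc ∑ k ∈ S, b k * μ (Q k) ≤ ∑ k ∈ S, b k * (c * μ (E k)) := by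
          gcongr with k hk
          exact hc k hk
      _ = c * 1 * ∑ k ∈ S, b k * μ (E k) := by
          rw [mul_one, Finset.mul_sum]
          simp_rw [mul_left_comm]
      _ ≤ _ := by gcongr
  set G : α → ℝ≥0∞ := fun x => ∑ k ∈ S, b k * (Q k).indicator (fun _ => 1) x
  set F : α → ℝ≥0∞ := fun x => ∑ k ∈ S, b k * (E k).indicator (fun _ => 1) x
  set q := p.conjExponent
  have hpq : p.HolderConjugate q := .conjExponent hp1
  have hGm : Measurable G := hmeas hQ
  have hFm : Measurable F := hmeas hE
  have hGfin : ∫⁻ x, G x ^ p ∂μ ≠ ∞ := lintegral_rpow_finset_sum_indicator_ne_top hQ hQtop hb hp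
  have hGint (k) (hk : k ∈ S) : ∫⁻ x in Q k, G x ^ (p - 1) ∂μ ≠ ∞ := by
    refine ne_top_of_le_ne_top (ENNReal.mul_ne_top (ENNReal.rpow_ne_top_of_nonneg
      (sub_nonneg.2 hp) (ENNReal.sum_ne_top.2 hb)) (hQtop k hk)) ?_
    rw [← setLIntegral_const]
    refine lintegral_mono fun x => ENNReal.rpow_le_rpow ?_ (sub_nonneg.2 hp)
    exact Finset.sum_le_sum fun k _ => mul_le_of_le_one_right' (Set.indicator_le_self' (by simp) x)
  have hM := measurable_finsetMaximal (μ := μ) hQ fun x => G x ^ (p - 1)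
  refine ENNReal.rpow_one_div_le_of_le_mul_rpow hpq hGfin ?_
  calc ∫⁻ x, G x ^ p ∂μ = ∫⁻ x, G x * G x ^ (p - 1) ∂μ := by
        refine lintegral_congr fun x => ?_
        nth_rw 2 [← ENNReal.rpow_one (G x)]
        rw [← ENNReal.rpow_add_of_nonneg _ _ zero_le_one (sub_nonneg.2 hp), add_sub_cancel]
    _ = ∑ k ∈ S, b k * ∫⁻ x in Q k, G x ^ (p - 1) ∂μ := hsum hQ (hGm.pow_const _)
    _ ≤ ∑ k ∈ S, c * (b k * ∫⁻ x in E k, finsetMaximal μ S Q (fun x => G x ^ (p - 1)) x ∂μ) := by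
      refine Finset.sum_le_sum fun k hk => ?_
      rw [mul_left_comm]
      refine mul_le_mul_right ?_ _
      rw [← measure_mul_setLAverage _ (hQtop k hk)]
      calc _ ≤ c * μ (E k) * ⨍⁻ x in Q k, G x ^ (p - 1) ∂μ := by gcongr; exact hc k hk
        _ = c * ∫⁻ _ in E k, (⨍⁻ x in Q k, G x ^ (p - 1) ∂μ) ∂μ := by
          rw [setLIntegral_const, mul_assoc, mul_comm (μ _)]
        _ ≤ _ := by
          gcongr c * ?_
          exact setLIntegral_mono hM fun x hx =>
            setLAverage_le_finsetMaximal (fun x => G x ^ (p - 1)) hk (hEQ k hk hx)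
    _ = c * ∫⁻ x, F x * finsetMaximal μ S Q (fun x => G x ^ (p - 1)) x ∂μ := by
      rw [← Finset.mul_sum, hsum hE hM]
    _ ≤ c * ((∫⁻ x, F x ^ p ∂μ) ^ (1 / p) *
          (∫⁻ x, finsetMaximal μ S Q (fun x => G x ^ (p - 1)) x ^ q ∂μ) ^ (1 / q)) := by
      gcongr
      exact ENNReal.lintegral_mul_le_Lp_mul_Lq μ hpq hFm.aemeasurable hM.aemeasurable
    _ ≤ c * ((∫⁻ x, F x ^ p ∂μ) ^ (1 / p) *
          (K * ENNReal.ofReal p * (∫⁻ x, (G x ^ (p - 1)) ^ q ∂μ) ^ (1 / q))) := by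
      gcongr
      exact hV.lintegral_finsetMaximal_rpow_le hQ hQ0 hQtop hpq (hGm.pow_const _) hGint
    _ = _ := by
      simp_rw [← ENNReal.rpow_mul, hpq.sub_one_mul_conj]
      ring

end Maximal

section Cube

variable {d : ℕ}

theorem measurableSet_cube (c : EuclideanSpace ℝ (Fin d)) (ℓ : ℝ) : MeasurableSet (cube c ℓ) := by
  have : IsClosed (cube c ℓ) := by
    simp only [cube, Set.ofPred_forall, Set.ofPred_and]
    refine isClosed_iInter fun i => (isClosed_le ?_ ?_).inter (isClosed_le ?_ ?_) <;> fun_prop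
  exact this.measurableSet

theorem volume_cube (c : EuclideanSpace ℝ (Fin d)) (ℓ : ℝ) :
    volume (cube c ℓ) = ENNReal.ofReal ℓ ^ d := by
  have : cube c ℓ = WithLp.ofLp ⁻¹' Set.Icc (WithLp.ofLp c) (fun i => c i + ℓ) := by
    ext x
    simp [cube, Pi.le_def, forall_and]
  rw [this, (PiLp.volume_preserving_ofLp (Fin d)).measure_preimage
    measurableSet_Icc.nullMeasurableSet, Real.volume_Icc_pi]
  simp

theorem volume_cube_mul (c c' : EuclideanSpace ℝ (Fin d)) {r : ℝ} (hr : 0 ≤ r) (ℓ : ℝ) :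
    volume (cube c (r * ℓ)) = ENNReal.ofReal r ^ d * volume (cube c' ℓ) := by
  rw [volume_cube, volume_cube, ENNReal.ofReal_mul hr, mul_pow]

theorem cube_nonempty (c : EuclideanSpace ℝ (Fin d)) {ℓ : ℝ} (hℓ : 0 ≤ ℓ) : (cube c ℓ).Nonempty :=
  ⟨c, fun i => ⟨le_rfl, by linarith⟩⟩

theorem vitaliProperty_cube {ι : Type*} (S : Finset ι) (c : ι → EuclideanSpace ℝ (Fin d))
    {ℓ : ι → ℝ} (hℓ : ∀ k, 0 < ℓ k) :
    VitaliProperty volume S (fun k => cube (c k) (ℓ k)) (5 ^ d) := by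
  intro T hT
  obtain ⟨u, huT, hdisj, hcov⟩ := Vitali.exists_disjoint_subfamily_covering_enlargement
    (fun k => cube (c k) (ℓ k)) T ℓ 2 one_lt_two (fun k _ => (hℓ k).le) (∑ k ∈ T, ℓ k)
    (fun k hk => Finset.single_le_sum (fun k _ => (hℓ k).le) hk)
    (fun k _ => cube_nonempty _ (hℓ k).le)
  lift u to Finset ι using T.finite_toSet.subset huT
  refine ⟨u, Finset.coe_subset.1 huT, hdisj, ?_⟩
  have hsub : ⋃ k ∈ T, cube (c k) (ℓ k) ⊆
      ⋃ k ∈ u, cube (WithLp.toLp 2 fun i => c k i - 2 * ℓ k) (5 * ℓ k) := by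
    refine Set.iUnion₂_subset fun a ha => ?_
    obtain ⟨b, hb, ⟨y, hya, hyb⟩, hab⟩ := hcov a ha
    refine fun x hx => Set.mem_biUnion hb fun i => ?_
    have := hx i
    have := hya i
    have := hyb i
    constructor <;> dsimp <;> linarith
  refine (measure_mono hsub).trans ((measure_biUnion_finset_le _ _).trans_eq ?_)
  rw [Finset.mul_sum]
  refine Finset.sum_congr rfl fun k _ => ?_
  rw [volume_cube_mul _ (c k) (by norm_num)]
  simp

theorem lintegral_tsum_indicator_cube_rpow_le {p : ℝ} (hp : 1 ≤ p)
    (cQ : ℕ → EuclideanSpace ℝ (Fin d)) {ℓ : ℕ → ℝ} (hℓ : ∀ k, 0 < ℓ k)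
    {E : ℕ → Set (EuclideanSpace ℝ (Fin d))} (hE : ∀ k, MeasurableSet (E k))
    (hEQ : ∀ k, E k ⊆ cube (cQ k) (ℓ k)) {c : ℝ≥0∞}
    (hc : ∀ k, volume (cube (cQ k) (ℓ k)) ≤ c * volume (E k)) {b : ℕ → ℝ≥0∞}
    (hb : ∀ k, b k ≠ ∞) :
    (∫⁻ x, (∑' k, b k * (cube (cQ k) (ℓ k)).indicator (fun _ => 1) x) ^ p) ^ (1 / p) ≤
      c * (5 ^ d * ENNReal.ofReal p) *
        (∫⁻ x, (∑' k, b k * (E k).indicator (fun _ => 1) x) ^ p) ^ (1 / p) := by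
  have hp0 : 0 < p := zero_lt_one.trans_le hp
  have hiSup (x : EuclideanSpace ℝ (Fin d)) :
      (∑' k, b k * (cube (cQ k) (ℓ k)).indicator (fun _ => 1) x) ^ p =
        ⨆ n, (∑ k ∈ Finset.range n, b k * (cube (cQ k) (ℓ k)).indicator (fun _ => 1) x) ^ p := by
    rw [ENNReal.tsum_eq_iSup_nat]
    exact (ENNReal.orderIsoRpow p hp0).map_iSup _
  simp_rw [hiSup]
  rw [lintegral_iSup, one_div, ENNReal.rpow_inv_le_iff hp0]
  · refine iSup_le fun n => ?_
    rw [← ENNReal.rpow_inv_le_iff hp0, ← one_div]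
    refine ((vitaliProperty_cube (Finset.range n) cQ hℓ).lintegral_sum_rpow_le
      (one_le_pow₀ (by norm_num)) (fun k _ => measurableSet_cube _ _) (fun k _ => ?_)
      (fun k _ => ?_) (fun k _ => hE k) (fun k _ => hEQ k) (fun k _ => hc k)
      (fun k _ => hb k) hp).trans ?_
    · simp [volume_cube, hℓ k]
    · simp [volume_cube]
    · gcongr
      exact ENNReal.sum_le_tsum _
  · exact fun n => (Finset.measurable_sum _ fun k _ =>
      (measurable_const.indicator (measurableSet_cube _ _)).const_mul _).pow_const _
  · intro m n hmn x
    dsimp only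
    gcongr

end Cube

/-- (1) If `E_k ⊆ Q_k` with `|E_k| ≥ η|Q_k|` then
`‖Σ λ_k 1_{Q_k}‖_p ≤ (C/η)‖Σ λ_k 1_{E_k}‖_p`. (2) If instead `Q̃_k` are cubes of the same
side length with `dist(Q_k,Q̃_k) ≤ A·ℓ(Q_k)` then
`‖Σ λ_k 1_{Q_k}‖_p ≤ C·A^d·‖Σ λ_k 1_{Q̃_k}‖_p`. Sums are pointwise in `[0,∞]`. -/
theorem statement8 (d : ℕ) (hd : 1 ≤ d) (p : ℝ) (hp : 1 ≤ p) :
    ∃ C : ℝ, 0 < C ∧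
      -- part (1)
      ((∀ η : ℝ, 0 < η → η < 1 →
        ∀ (cQ : ℕ → EuclideanSpace ℝ (Fin d)) (ℓ : ℕ → ℝ), (∀ k, 0 < ℓ k) →
        ∀ Es : ℕ → Set (EuclideanSpace ℝ (Fin d)),
          (∀ k, MeasurableSet (Es k)) →
          (∀ k, Es k ⊆ cube (cQ k) (ℓ k)) →
          (∀ k, ENNReal.ofReal η * volume (cube (cQ k) (ℓ k)) ≤ volume (Es k)) →
        ∀ lam : ℕ → ℝ, (∀ k, 0 ≤ lam k) →
          (∫⁻ x, (∑' k, ENNReal.ofReal (lam k) *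
              Set.indicator (cube (cQ k) (ℓ k)) (fun _ => (1 : ℝ≥0∞)) x) ^ p) ^ (1 / p)
            ≤ ENNReal.ofReal (C / η) *
              (∫⁻ x, (∑' k, ENNReal.ofReal (lam k) *
                Set.indicator (Es k) (fun _ => (1 : ℝ≥0∞)) x) ^ p) ^ (1 / p)) ∧
      -- part (2)
      (∀ A : ℝ, 1 ≤ A →
        ∀ (cQ cQt : ℕ → EuclideanSpace ℝ (Fin d)) (ℓ : ℕ → ℝ), (∀ k, 0 < ℓ k) →
          (∀ k, ∃ x ∈ cube (cQ k) (ℓ k), ∃ y ∈ cube (cQt k) (ℓ k), dist x y ≤ A * ℓ k) →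
        ∀ lam : ℕ → ℝ, (∀ k, 0 ≤ lam k) →
          (∫⁻ x, (∑' k, ENNReal.ofReal (lam k) *
              Set.indicator (cube (cQ k) (ℓ k)) (fun _ => (1 : ℝ≥0∞)) x) ^ p) ^ (1 / p)
            ≤ ENNReal.ofReal (C * A ^ d) *
              (∫⁻ x, (∑' k, ENNReal.ofReal (lam k) *
                Set.indicator (cube (cQt k) (ℓ k)) (fun _ => (1 : ℝ≥0∞)) x) ^ p) ^ (1 / p))) := by
  have hp0 : 0 < p := zero_lt_one.trans_le hp
  have main {r : ℝ} (hr : 0 < r) (cQ : ℕ → EuclideanSpace ℝ (Fin d)) (ℓ : ℕ → ℝ)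
      (hℓ : ∀ k, 0 < ℓ k) (E : ℕ → Set (EuclideanSpace ℝ (Fin d)))
      (hE : ∀ k, MeasurableSet (E k)) (hEQ : ∀ k, E k ⊆ cube (cQ k) (ℓ k))
      (hc : ∀ k, ENNReal.ofReal r * volume (cube (cQ k) (ℓ k)) ≤ volume (E k)) (lam : ℕ → ℝ) :
      (∫⁻ x, (∑' k, ENNReal.ofReal (lam k) *
          Set.indicator (cube (cQ k) (ℓ k)) (fun _ => (1 : ℝ≥0∞)) x) ^ p) ^ (1 / p)
        ≤ ENNReal.ofReal (5 ^ d * p / r) *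
          (∫⁻ x, (∑' k, ENNReal.ofReal (lam k) *
            Set.indicator (E k) (fun _ => (1 : ℝ≥0∞)) x) ^ p) ^ (1 / p) := by
    have hr0 : ENNReal.ofReal r ≠ 0 := by simpa using hr
    refine (lintegral_tsum_indicator_cube_rpow_le hp cQ hℓ hE hEQ (c := (ENNReal.ofReal r)⁻¹)
      (fun k => ?_) fun k => ENNReal.ofReal_ne_top).trans_eq ?_
    · rw [← ENNReal.div_eq_inv_mul, ENNReal.le_div_iff_mul_le (.inl hr0)
        (.inl ENNReal.ofReal_ne_top), mul_comm]
      exact hc k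
    · congr 1
      rw [ENNReal.ofReal_div_of_pos hr, ENNReal.ofReal_mul (by positivity),
        ENNReal.ofReal_pow (by norm_num), ENNReal.div_eq_inv_mul]
      simp
  refine ⟨5 ^ d * p * 5 ^ d, by positivity, fun η hη _ cQ ℓ hℓ E hE hEQ hc lam _ => ?_,
    fun A hA cQ cQt ℓ hℓ hdist lam _ => ?_⟩
  · refine (main hη cQ ℓ hℓ E hE hEQ hc lam).trans ?_
    gcongr ENNReal.ofReal (?_ / η) * _
    exact le_mul_of_one_le_right (by positivity) (one_le_pow₀ (by norm_num : (1 : ℝ) ≤ 5))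
  · have hA0 : 0 < A := zero_lt_one.trans_le hA
    set cB : ℕ → EuclideanSpace ℝ (Fin d) := fun k => WithLp.toLp 2 fun i => cQt k i - 2 * A * ℓ k
    have hAℓ (k) : ℓ k ≤ A * ℓ k := le_mul_of_one_le_left (hℓ k).le hA
    have hsub (k) : cube (cQ k) (ℓ k) ⊆ cube (cB k) (5 * A * ℓ k) := by
      obtain ⟨x, hx, y, hy, hxy⟩ := hdist k
      intro z hz i
      have hxyi : |x i - y i| ≤ A * ℓ k := by
        rw [← Real.dist_eq]
        exact (PiLp.dist_apply_le x y i).trans hxy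
      have := abs_le.1 hxyi
      have := hx i
      have := hy i
      have := hz i
      have := hAℓ k
      constructor <;> dsimp [cB] <;> linarith
    have hsubt (k) : cube (cQt k) (ℓ k) ⊆ cube (cB k) (5 * A * ℓ k) := by
      intro z hz i
      have := hz i
      have := hAℓ k
      have := hℓ k
      constructor <;> dsimp [cB] <;> linarith
    refine le_trans ?_ ((main (r := ((5 * A) ^ d)⁻¹) (by positivity) cB (fun k => 5 * A * ℓ k)
      (fun k => by have := hℓ k; positivity) (fun k => cube (cQt k) (ℓ k))
      (fun k => measurableSet_cube _ _) hsubt (fun k => ?_) lam).trans_eq ?_)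
    · gcongr with x k
      exact hsub k
    · rw [volume_cube_mul _ (cQt k) (by positivity), ← mul_assoc,
        ← ENNReal.ofReal_pow (by positivity), ← ENNReal.ofReal_mul (by positivity),
        inv_mul_cancel₀ (by positivity), ENNReal.ofReal_one, one_mul]
    · rw [div_inv_eq_mul, mul_pow, ← mul_assoc]
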